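/- For every f ∈ C(X_1) and every ε > 0, the function F ↦ log P^a_r(X_r,f,F,ε) on nonempty finite subsets of G is right-invariant (its value at Fg equals its value at F for every g ∈ G) and sub-additive on disjoint unions, and consequently the limit lim_{n→∞} (log P^a_r(X_r,f,F_n,ε))/|F_n| exists for every Følner sequence {F_n} of G and is independent of the choice of Følner sequence. -/

import Mathlib

open scoped BigOperators NNReal
open Filter

namespace WPP

variable (G : Type) [Group G]

/-- `B(F,K) = {g ∈ G : Kg ∩ F ≠ ∅ and Kg ∩ (G∖F) ≠ ∅}`. -/
def folnerB (F K : Finset G) : Set G :=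
  {g : G | (∃ k ∈ K, k * g ∈ F) ∧ ∃ k ∈ K, k * g ∉ F}

/-- A Følner sequence of `G`. -/
def IsFolner (F : ℕ → Finset G) : Prop :=
  (∀ n, (F n).Nonempty) ∧
    ∀ K : Finset G, K.Nonempty →
      Tendsto (fun n => ((folnerB G (F n) K).ncard : ℝ) / ((F n).card : ℝ)) atTop (nhds 0)

/-- A `G`-system: a compact metric space together with a continuous action of `G`
by homeomorphisms. -/
structure GSystem where
  carrier : Type
  [metric : MetricSpace carrier]
  [cpt : CompactSpace carrier]
  act : G → carrier → carrier
  one_act : ∀ x, act 1 x = x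
  mul_act : ∀ g h x, act (g * h) x = act g (act h x)
  cont_act : ∀ g, Continuous (act g)

attribute [instance] GSystem.metric GSystem.cpt

variable {G}

noncomputable instance (S : GSystem G) : MeasurableSpace S.carrier := borel S.carrier
instance (S : GSystem G) : BorelSpace S.carrier := ⟨rfl⟩

/-- A factor map between `G`-systems: a continuous equivariant surjection. -/
structure FactorMap (S T : GSystem G) where
  toFun : S.carrier → T.carrier
  cont : Continuous toFun
  surj : Function.Surjective toFun
  equiv : ∀ g x, toFun (S.act g x) = T.act g (toFun x)

/-- The dynamical (Bowen) metric `d_F(x,y) = max_{g∈F} d(gx,gy)`. -/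
noncomputable def dynDist (S : GSystem G) (F : Finset G) (x y : S.carrier) : ℝ :=
  ((F.sup fun g => nndist (S.act g x) (S.act g y) : ℝ≥0) : ℝ)

/-- `diam(U, d_F) < ε`. -/
def diamLT (S : GSystem G) (F : Finset G) (U : Set S.carrier) (ε : ℝ) : Prop :=
  ∀ x ∈ U, ∀ y ∈ U, dynDist S F x y < ε

/-- The Birkhoff-type sum `S_F f(x) = Σ_{g∈F} f(gx)`. -/
noncomputable def birk (S : GSystem G) (f : S.carrier → ℝ) (F : Finset G) (x : S.carrier) : ℝ :=
  ∑ g ∈ F, f (S.act g x)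

variable (X : ℕ → GSystem G) (π : ∀ i, FactorMap (X i) (X (i + 1)))

/-- The recursively defined weighted quantities `P^a_{i+1}(Ω, f, F, ε)` (0-indexed: `wP … i`
corresponds to the paper's `P^a_{i+1}`, and `a i` to the paper's `a_{i+1}`). -/
noncomputable def wP (a : ℕ → ℝ) (f : (X 0).carrier → ℝ) (F : Finset G) (ε : ℝ) :
    (i : ℕ) → Set (X i).carrier → ℝ
  | 0, Ω => sInf {s | ∃ (n : ℕ) (U : Fin n → Set (X 0).carrier),
      (∀ j, IsOpen (U j)) ∧ (Ω ⊆ ⋃ j, U j) ∧ (∀ j, diamLT (X 0) F (U j) ε) ∧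
      s = ∑ j, Real.exp (sSup (birk (X 0) f F '' U j))}
  | i + 1, Ω => sInf {s | ∃ (n : ℕ) (U : Fin n → Set (X (i + 1)).carrier),
      (∀ j, IsOpen (U j)) ∧ (Ω ⊆ ⋃ j, U j) ∧ (∀ j, diamLT (X (i + 1)) F (U j) ε) ∧
      s = ∑ j, (wP a f F ε i ((π i).toFun ⁻¹' U j)) ^ (a i)}

/-- `lim_n log P^a_r(X_r, f, F_n, ε) / |F_n|` (realized as a `limsup` in `EReal`; by the
Ornstein–Weiss lemma the limit exists, so this is the limit). -/
noncomputable def pressEps (r : ℕ) (a : ℕ → ℝ) (f : (X 0).carrier → ℝ)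
    (Fn : ℕ → Finset G) (ε : ℝ) : EReal :=
  limsup (fun n =>
    ((Real.log (wP X π a f (Fn n) ε (r - 1) Set.univ) / ((Fn n).card : ℝ) : ℝ) : EReal)) atTop

/-- The `a`-weighted topological pressure `P^a(f,G) = lim_{ε→0} P^a(X_r,f,ε)`; since
`P^a(X_r,f,ε)` is non-decreasing as `ε` decreases, the limit equals the supremum over `ε > 0`. -/
noncomputable def press (r : ℕ) (a : ℕ → ℝ) (f : (X 0).carrier → ℝ)
    (Fn : ℕ → Finset G) : EReal :=
  ⨆ (ε : ℝ) (_ : 0 < ε), pressEps X π r a f Fn ε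

/-- Entropy `H_μ(p)` of a countable partition given by the fibers of `p`. -/
noncomputable def Hpart {Y : Type} [MeasurableSpace Y] {ι : Type}
    (μ : MeasureTheory.Measure Y) (p : Y → ι) : ℝ :=
  ∑' i : ι, Real.negMulLog ((μ (p ⁻¹' {i})).toReal)

/-- `h_μ(p, G) = lim_n H_μ(p_{F_n})/|F_n|` (realized as a `limsup`, which equals the limit
since the limit exists). -/
noncomputable def hSeq (S : GSystem G) (Fn : ℕ → Finset G)
    (μ : MeasureTheory.Measure S.carrier) (p : S.carrier → ℕ) : ℝ :=
  limsup (fun n =>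
    Hpart μ (fun x => fun g : (Fn n : Finset G) => p (S.act (g : G) x)) / ((Fn n).card : ℝ)) atTop

/-- The measure-theoretic entropy `h_μ(X,G)`: supremum of `h_μ(α,G)` over all finite
measurable partitions (encoded as measurable maps to `ℕ` with finite range). -/
noncomputable def mEnt (S : GSystem G) (Fn : ℕ → Finset G)
    (μ : MeasureTheory.Measure S.carrier) : EReal :=
  ⨆ p : {p : S.carrier → ℕ // Measurable p ∧ (Set.range p).Finite},
    ((hSeq S Fn μ p.1 : ℝ) : EReal)

/-- `μ ∈ M^G(X)`: a `G`-invariant Borel probability measure. -/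
def IsInvProb (S : GSystem G) (μ : MeasureTheory.Measure S.carrier) : Prop :=
  MeasureTheory.IsProbabilityMeasure μ ∧ ∀ g : G, μ.map (S.act g) = μ

/-- `π^{(i)} = π_i ∘ ⋯ ∘ π_1 : X_1 → X_{i+1}` (0-indexed). -/
noncomputable def chainMap : (i : ℕ) → (X 0).carrier → (X i).carrier
  | 0 => id
  | i + 1 => (π i).toFun ∘ chainMap i

/-- The weights `w_1 = a_1⋯a_{r−1}`, `w_i = (1−a_{i−1})a_i⋯a_{r−1}`, `w_r = 1−a_{r−1}`
(0-indexed: `wt a r i` is the paper's `w_{i+1}`, `a j` the paper's `a_{j+1}`). -/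
noncomputable def wt (a : ℕ → ℝ) (r i : ℕ) : ℝ :=
  if i = 0 then ∏ j ∈ Finset.range (r - 1), a j
  else (1 - a (i - 1)) * ∏ j ∈ Finset.Ico i (r - 1), a j

/-- `Σ_{i=1}^r w_i h_{μ_i}(X_i,G) + w_1 ∫ f dμ`. -/
noncomputable def wSum (r : ℕ) (a : ℕ → ℝ) (Fn : ℕ → Finset G) (f : (X 0).carrier → ℝ)
    (μ : MeasureTheory.Measure (X 0).carrier) : EReal :=
  (∑ i ∈ Finset.range r, ((wt a r i : ℝ) : EReal) * mEnt (X i) Fn (μ.map (chainMap X π i)))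
    + (((wt a r 0) * ∫ x, f x ∂μ : ℝ) : EReal)

/-- `P^a_var(f,G) = sup_{μ ∈ M^G(X_1)} ( Σ w_i h_{μ_i}(X_i,G) + w_1 ∫ f dμ )`. -/
noncomputable def Pvar (r : ℕ) (a : ℕ → ℝ) (Fn : ℕ → Finset G)
    (f : (X 0).carrier → ℝ) : EReal :=
  ⨆ μ : {μ : MeasureTheory.Measure (X 0).carrier // IsInvProb (X 0) μ},
    wSum X π r a Fn f μ.1

end WPP

namespace WPP

section OrnsteinWeiss

variable {G : Type} [Group G]

theorem folnerB_finite (F K : Finset G) : (folnerB G F K).Finite := by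
  classical
  refine (K.biUnion fun k => F.image fun x => k⁻¹ * x).finite_toSet.subset ?_
  rintro g ⟨⟨k, hk, hkg⟩, -⟩
  simp only [Finset.coe_biUnion, Set.mem_iUnion, Finset.mem_coe, Finset.mem_image]
  exact ⟨k, hk, k * g, hkg, by group⟩

theorem folnerB_mono (F : Finset G) {K L : Finset G} (h : K ⊆ L) :
    folnerB G F K ⊆ folnerB G F L := by
  rintro g ⟨⟨k, hk, hkg⟩, ⟨l, hl, hlg⟩⟩
  exact ⟨⟨k, h hk, hkg⟩, ⟨l, h hl, hlg⟩⟩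

theorem folnerB_ncard_mono (F : Finset G) {K L : Finset G} (h : K ⊆ L) :
    (folnerB G F K).ncard ≤ (folnerB G F L).ncard :=
  Set.ncard_le_ncard (folnerB_mono F h) (folnerB_finite F L)

/-- The nonempty finite sets whose `K`-boundary has relative size at most `δ`. -/
def almostInvariant (K : Finset G) (δ : ℝ) : Set (Finset G) :=
  {D | D.Nonempty ∧ ((folnerB G D K).ncard : ℝ) ≤ δ * D.card}

theorem almostInvariant_subset {K L : Finset G} {δ δ' : ℝ} (hK : K ⊆ L) (hδ : δ ≤ δ') :
    almostInvariant L δ ⊆ almostInvariant K δ' := by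
  rintro D ⟨hD, h⟩
  refine ⟨hD, le_trans (by exact_mod_cast folnerB_ncard_mono D hK) (h.trans ?_)⟩
  gcongr

variable (G) in
/-- The filter of increasingly invariant nonempty finite subsets of `G`. -/
def folnerFilter : Filter (Finset G) :=
  ⨅ p : Finset G × {δ : ℝ // 0 < δ}, 𝓟 (almostInvariant p.1 p.2)

theorem folnerFilter_hasBasis :
    (folnerFilter G).HasBasis (fun _ : Finset G × {δ : ℝ // 0 < δ} => True)
      fun p => almostInvariant p.1 p.2 := by
  classical
  have : Nonempty {δ : ℝ // 0 < δ} := ⟨⟨1, one_pos⟩⟩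
  refine hasBasis_iInf_principal ?_
  rintro ⟨K, δ, hδ⟩ ⟨L, δ', hδ'⟩
  exact ⟨⟨K ∪ L, min δ δ', lt_min hδ hδ'⟩,
    almostInvariant_subset Finset.subset_union_left (min_le_left _ _),
    almostInvariant_subset Finset.subset_union_right (min_le_right _ _)⟩

theorem IsFolner.tendsto_folnerFilter {F : ℕ → Finset G} (hF : IsFolner G F) :
    Tendsto F atTop (folnerFilter G) := by
  classical
  rw [folnerFilter_hasBasis.tendsto_right_iff]
  rintro ⟨K, δ, hδ⟩ -
  have h := hF.2 (insert 1 K) (Finset.insert_nonempty _ _)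
  filter_upwards [h.eventually_lt_const hδ] with n hn
  refine almostInvariant_subset (Finset.subset_insert 1 K) le_rfl ⟨hF.1 n, ?_⟩
  have : (0 : ℝ) < (F n).card := by exact_mod_cast (hF.1 n).card_pos
  exact ((div_lt_iff₀ this).1 hn).le

variable [DecidableEq G]

theorem folnerB_image_mul_right_ncard_le (K L : Finset G) (c : G) :
    (folnerB G (K.image fun x => x * c) L).ncard ≤ (folnerB G K L).ncard := by
  have : folnerB G (K.image fun x => x * c) L ⊆ (fun x => x * c) '' folnerB G K L := by
    have key : ∀ y, y ∈ K.image (fun x => x * c) ↔ y * c⁻¹ ∈ K := fun y => by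
      simp only [Finset.mem_image]
      exact ⟨fun ⟨x, hx, e⟩ => by simpa [← e] using hx, fun h => ⟨_, h, by group⟩⟩
    rintro g ⟨⟨k, hk, hkg⟩, ⟨l, hl, hlg⟩⟩
    rw [key] at hkg hlg
    exact ⟨g * c⁻¹, ⟨⟨k, hk, by rwa [← mul_assoc]⟩, ⟨l, hl, by rwa [← mul_assoc]⟩⟩, by group⟩
  exact (Set.ncard_le_ncard this ((folnerB_finite K L).image _)).trans
    (Set.ncard_image_le (folnerB_finite K L))

/-- The union of the right translates `K c`, `c ∈ P`. -/
def translates (K P : Finset G) : Finset G :=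
  P.biUnion fun c => K.image fun x => x * c

theorem folnerB_sdiff_translates_ncard_le (D K L P : Finset G) :
    (folnerB G (D \ translates K P) L).ncard
      ≤ (folnerB G D L).ncard + P.card * (folnerB G K L).ncard := by
  have hsub : folnerB G (D \ translates K P) L
      ⊆ folnerB G D L ∪ ⋃ c ∈ P, folnerB G (K.image fun x => x * c) L := by
    rintro g ⟨⟨k, hk, hkg⟩, ⟨l, hl, hlg⟩⟩
    rw [Finset.mem_sdiff] at hkg hlg
    by_cases hD : l * g ∈ D
    · right
      have hA : l * g ∈ translates K P := by
        by_contra h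
        exact hlg ⟨hD, h⟩
      obtain ⟨c, hc, hlc⟩ := Finset.mem_biUnion.1 hA
      refine Set.mem_iUnion₂.2 ⟨c, hc, ⟨l, hl, hlc⟩, ⟨k, hk, fun h => hkg.2 ?_⟩⟩
      exact Finset.mem_biUnion.2 ⟨c, hc, h⟩
    · exact Or.inl ⟨⟨k, hk, hkg.1⟩, ⟨l, hl, hD⟩⟩
  have hfin : (⋃ c ∈ P, folnerB G (K.image fun x => x * c) L).Finite :=
    P.finite_toSet.biUnion fun c _ => folnerB_finite _ _
  refine (Set.ncard_le_ncard hsub ((folnerB_finite D L).union hfin)).trans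
    ((Set.ncard_union_le _ _).trans (Nat.add_le_add_left ?_ _))
  refine (Finset.set_ncard_biUnion_le P _).trans ?_
  rw [← smul_eq_mul]
  exact Finset.sum_le_card_nsmul _ _ _ fun c _ => folnerB_image_mul_right_ncard_le K L c

/-- Greedy filling of `D` by almost disjoint right translates of `K`. -/
theorem exists_filling {K D : Finset G} (hK : K.Nonempty) {ε : ℝ} (hε0 : 0 < ε) (hε1 : ε ≤ 1) :
    ∃ P : Finset G, translates K P ⊆ D ∧
      (1 - ε) * K.card * P.card ≤ (translates K P).card ∧
      ε * (D.card - (folnerB G D K).ncard) ≤ (translates K P).card := by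
  obtain ⟨k₀, hk₀⟩ := hK
  have hKpos : (0 : ℝ) < K.card := by exact_mod_cast Finset.card_pos.2 ⟨k₀, hk₀⟩
  set R : Finset G := (D.image fun x => k₀⁻¹ * x).filter fun c => ∀ k ∈ K, k * c ∈ D
  have hRcard : (D.card : ℝ) ≤ R.card + (folnerB G D K).ncard := by
    have hsub : ((D.image fun x => k₀⁻¹ * x : Finset G) : Set G) ⊆ ↑R ∪ folnerB G D K := by
      intro c hc
      by_cases h : ∀ k ∈ K, k * c ∈ D
      · exact Or.inl (Finset.mem_coe.2 (Finset.mem_filter.2 ⟨hc, h⟩))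
      · push Not at h
        obtain ⟨x, hx, rfl⟩ := Finset.mem_image.1 (Finset.mem_coe.1 hc)
        exact Or.inr ⟨⟨k₀, hk₀, by simpa using hx⟩, h⟩
    have h1 := (Set.ncard_le_ncard hsub (R.finite_toSet.union (folnerB_finite D K))).trans
      (Set.ncard_union_le _ _)
    rw [Set.ncard_coe_finset, Set.ncard_coe_finset,
      Finset.card_image_of_injective _ (mul_right_injective _)] at h1
    exact_mod_cast h1
  obtain ⟨P, hP, hmax⟩ := Finset.exists_max_image
    (R.powerset.filter fun P => (1 - ε) * K.card * P.card ≤ ((translates K P).card : ℝ))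
    Finset.card ⟨∅, by simp [translates]⟩
  rw [Finset.mem_filter, Finset.mem_powerset] at hP
  have hcardK : ∀ c : G, (K.image fun x => x * c).card = K.card := fun c =>
    Finset.card_image_of_injective _ (mul_left_injective _)
  refine ⟨P, ?_, hP.2, ?_⟩
  · intro y hy
    obtain ⟨c, hc, hy⟩ := Finset.mem_biUnion.1 hy
    obtain ⟨k, hk, rfl⟩ := Finset.mem_image.1 hy
    exact (Finset.mem_filter.1 (hP.1 hc)).2 k hk
  set A := translates K P with hA
  have hhit : ∀ c ∈ R, ε * K.card ≤ (((K.image fun x => x * c) ∩ A).card : ℝ) := by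
    intro c hc
    by_cases hcP : c ∈ P
    · have hKA : (K.image fun x => x * c) ⊆ A :=
        Finset.subset_biUnion_of_mem (fun c => K.image fun x => x * c) hcP
      rw [Finset.inter_eq_left.2 hKA, hcardK]
      exact mul_le_of_le_one_left hKpos.le hε1
    · by_contra! hlt
      have hins : translates K (insert c P) = (K.image fun x => x * c) ∪ A := by
        simp [translates, hA, Finset.biUnion_insert]
      have hun := Finset.card_union_add_card_inter (K.image fun x => x * c) A
      rw [hcardK] at hun
      have hun' : (((K.image fun x => x * c) ∪ A).card : ℝ) + ((K.image fun x => x * c) ∩ A).card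
          = K.card + A.card := by exact_mod_cast hun
      have := hmax (insert c P) (by
        rw [Finset.mem_filter, Finset.mem_powerset]
        refine ⟨Finset.insert_subset hc hP.1, ?_⟩
        rw [hins, Finset.card_insert_of_notMem hcP]
        push_cast
        nlinarith [hP.2])
      rw [Finset.card_insert_of_notMem hcP] at this
      omega
  have hcount : ∑ c ∈ R, ((K.image fun x => x * c) ∩ A).card ≤ A.card * K.card := by
    have h1 : ∀ c, ((K.image fun x => x * c) ∩ A).card
        = ∑ y ∈ A, if y * c⁻¹ ∈ K then 1 else 0 := by
      intro c
      rw [← Finset.sum_filter, Finset.sum_const, smul_eq_mul, mul_one]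
      congr 1
      ext y
      simp only [Finset.mem_inter, Finset.mem_image, Finset.mem_filter]
      constructor
      · rintro ⟨⟨x, hx, rfl⟩, hy⟩
        exact ⟨hy, by simpa using hx⟩
      · rintro ⟨hy, hx⟩
        exact ⟨⟨_, hx, by group⟩, hy⟩
    simp_rw [h1]
    rw [Finset.sum_comm, ← smul_eq_mul]
    refine Finset.sum_le_card_nsmul _ _ _ fun y _ => ?_
    rw [← Finset.sum_filter, Finset.sum_const, smul_eq_mul, mul_one]
    refine Finset.card_le_card_of_injOn (fun c => y * c⁻¹) (fun c hc => ?_) ?_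
    · exact (Finset.mem_filter.1 hc).2
    · intro c _ d _ e
      simpa using e
  have hsum : (R.card : ℝ) * (ε * K.card) ≤ A.card * K.card := by
    have h2 := Finset.card_nsmul_le_sum R _ _ hhit
    rw [nsmul_eq_mul] at h2
    exact h2.trans (by exact_mod_cast hcount)
  have h3 : ε * R.card ≤ A.card := by
    refine le_of_mul_le_mul_right ?_ hKpos
    linarith
  nlinarith

variable {h : Finset G → ℝ}

theorem apply_translates_le (hsub : ∀ E F, h (E ∪ F) ≤ h E + h F)
    (hinv : ∀ F g, h (F.image fun x => x * g) = h F) (h0 : h ∅ = 0) (K P : Finset G) :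
    h (translates K P) ≤ P.card * h K := by
  induction P using Finset.induction_on with
  | empty => simp [translates, h0]
  | insert c P hc ih =>
    have : translates K (insert c P) = (K.image fun x => x * c) ∪ translates K P := by
      simp [translates, Finset.biUnion_insert]
    rw [this, Finset.card_insert_of_notMem hc]
    push_cast
    linarith [hsub (K.image fun x => x * c) (translates K P), hinv K c]

theorem apply_le_card_mul (hsub : ∀ E F, h (E ∪ F) ≤ h E + h F)
    (hinv : ∀ F g, h (F.image fun x => x * g) = h F) (h0 : h ∅ = 0) (D : Finset G) :
    h D ≤ D.card * h {1} := by
  have := apply_translates_le hsub hinv h0 {1} D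
  have hD : translates {1} D = D := by
    ext
    simp [translates]
  rwa [hD] at this

/-- One filling step: comparison of an upper growth rate `s` with the ratio at a tile. -/
theorem growth_le_of_filling (hmono : Monotone h) (hsub : ∀ E F, h (E ∪ F) ≤ h E + h F)
    (hinv : ∀ F g, h (F.image fun x => x * g) = h F) (h0 : h ∅ = 0)
    {s t : ℝ} {ε : ℝ} (hε0 : 0 < ε) (hε : ε ≤ 1 / 2)
    (hupper : ∀ᶠ D in folnerFilter G, h D / D.card < s + ε ^ 2)
    (hfreq : ∃ᶠ D in folnerFilter G, s - ε ^ 2 < h D / D.card)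
    (hlower : ∃ᶠ D in folnerFilter G, h D / D.card < t + ε ^ 2) :
    s ≤ 4 * ε + ε ^ 2 + h {1} * ε + (t + ε ^ 2) / (1 - ε) := by
  have hnn : ∀ D, 0 ≤ h D := fun D => h0 ▸ hmono (Finset.empty_subset D)
  obtain ⟨⟨L, δ, hδ⟩, -, hL⟩ := folnerFilter_hasBasis.eventually_iff.1 hupper
  obtain ⟨K, ⟨hK, hKL⟩, hKt⟩ := folnerFilter_hasBasis.frequently_iff.1 hlower
    ⟨L, ε * δ / 4, by positivity⟩ trivial
  obtain ⟨D, hDinv, hDs⟩ := folnerFilter_hasBasis.frequently_iff.1 hfreq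
    ⟨L ∪ K, min (ε * δ / 2) (1 / 2), by positivity⟩ trivial
  have hDL := (almostInvariant_subset (K := L) Finset.subset_union_left (min_le_left _ _) hDinv).2
  have hDK := (almostInvariant_subset (K := K) Finset.subset_union_right (min_le_right _ _) hDinv).2
  obtain ⟨P, hPD, hPcard, hPbig⟩ := exists_filling (D := D) hK hε0 (by linarith)
  have hres := folnerB_sdiff_translates_ncard_le D K L P
  set A := translates K P with hA
  have hDpos : (0 : ℝ) < D.card := by exact_mod_cast hDinv.1.card_pos
  have hKpos : (0 : ℝ) < K.card := by exact_mod_cast hK.card_pos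
  have hsplit : ((D \ A).card : ℝ) + A.card = D.card := by
    exact_mod_cast Finset.card_sdiff_add_card_eq_card hPD
  have hAbig : ε * D.card / 2 ≤ A.card := by
    have := mul_le_mul_of_nonneg_left hDK hε0.le
    linarith
  have hhA : h A ≤ A.card * ((t + ε ^ 2) / (1 - ε)) := by
    have h1 := apply_translates_le hsub hinv h0 K P
    rw [div_lt_iff₀ hKpos] at hKt
    have ht : 0 ≤ t + ε ^ 2 := by
      by_contra! hneg
      linarith [hnn K, mul_neg_of_neg_of_pos hneg hKpos]
    rw [← mul_div_assoc, le_div_iff₀ (by linarith)]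
    calc h A * (1 - ε) ≤ P.card * ((t + ε ^ 2) * K.card) * (1 - ε) := by
          gcongr
          · linarith
          · exact h1.trans (by gcongr)
      _ = (1 - ε) * K.card * P.card * (t + ε ^ 2) := by ring
      _ ≤ A.card * (t + ε ^ 2) := by gcongr
  have hhD : h D ≤ h (D \ A) + h A := by
    have := hsub (D \ A) A
    rwa [Finset.sdiff_union_of_subset hPD] at this
  rw [lt_div_iff₀ hDpos] at hDs
  set w := (t + ε ^ 2) / (1 - ε)
  have hw0 : 0 ≤ w := by
    by_contra! hneg
    have : (0 : ℝ) < A.card := lt_of_lt_of_le (by positivity) hAbig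
    linarith [hnn A, mul_neg_of_pos_of_neg this hneg]
  have hAD : (A.card : ℝ) ≤ D.card := by
    have : (0 : ℝ) ≤ (D \ A).card := by positivity
    linarith
  have hu0 : 0 ≤ h {1} * ε := mul_nonneg (hnn _) hε0.le
  rcases le_or_gt (ε * D.card) ((D \ A).card : ℝ) with hbig | hsmall
  · have hD'pos : (0 : ℝ) < (D \ A).card := lt_of_lt_of_le (by positivity) hbig
    have hD'inv : D \ A ∈ almostInvariant L δ := by
      refine ⟨Finset.card_pos.1 (by exact_mod_cast hD'pos), ?_⟩
      have h1 : ((folnerB G (D \ A) L).ncard : ℝ)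
          ≤ (folnerB G D L).ncard + P.card * (folnerB G K L).ncard := by exact_mod_cast hres
      have h2 : (K.card : ℝ) * P.card ≤ 2 * D.card := by
        have : (0 : ℝ) ≤ K.card * P.card := by positivity
        linarith [mul_le_mul_of_nonneg_right hε this]
      dsimp only at hKL hDL
      calc ((folnerB G (D \ A) L).ncard : ℝ)
          ≤ (folnerB G D L).ncard + P.card * (folnerB G K L).ncard := h1
        _ ≤ ε * δ / 2 * D.card + P.card * (ε * δ / 4 * K.card) := by gcongr
        _ = ε * δ / 2 * D.card + ε * δ / 4 * (K.card * P.card) := by ring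
        _ ≤ ε * δ / 2 * D.card + ε * δ / 4 * (2 * D.card) := by gcongr
        _ = δ * (ε * D.card) := by ring
        _ ≤ δ * (D \ A).card := by gcongr
    have h3 := hL hD'inv
    rw [div_lt_iff₀ hD'pos] at h3
    have hApos : (0 : ℝ) < A.card := lt_of_lt_of_le (by positivity) hAbig
    have h4 : s * A.card ≤ 2 * ε ^ 2 * D.card + A.card * w := by
      rw [← hsplit] at hDs ⊢
      linarith [mul_nonneg (sq_nonneg ε) hApos.le]
    have h5 : s * A.card ≤ (4 * ε + w) * A.card := by
      linarith [mul_le_mul_of_nonneg_left hAbig (show 0 ≤ 4 * ε by positivity)]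
    have := le_of_mul_le_mul_right h5 hApos
    linarith [sq_nonneg ε]
  · have h3 := apply_le_card_mul hsub hinv h0 (D \ A)
    have h4 : (s - ε ^ 2) * D.card ≤ (h {1} * ε + w) * D.card := by
      linarith [mul_le_mul_of_nonneg_right hsmall.le (hnn {1}),
        mul_le_mul_of_nonneg_right hAD hw0]
    have := le_of_mul_le_mul_right h4 hDpos
    linarith

/-- The Ornstein–Weiss lemma. -/
theorem exists_tendsto_div_card [(folnerFilter G).NeBot] (hmono : Monotone h)
    (hsub : ∀ E F, h (E ∪ F) ≤ h E + h F)
    (hinv : ∀ F g, h (F.image fun x => x * g) = h F) (h0 : h ∅ = 0) :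
    ∃ l, Tendsto (fun D => h D / D.card) (folnerFilter G) (nhds l) := by
  have hnn : ∀ D, 0 ≤ h D := fun D => h0 ▸ hmono (Finset.empty_subset D)
  set u : Finset G → ℝ := fun D => h D / D.card
  have hlow : ∀ D, 0 ≤ u D := fun D => div_nonneg (hnn D) (by positivity)
  have hup : ∀ D, u D ≤ h {1} := fun D =>
    div_le_of_le_mul₀ (by positivity) (hnn _)
      (by linarith [apply_le_card_mul hsub hinv h0 D])
  have hbl : IsBoundedUnder (· ≥ ·) (folnerFilter G) u := isBoundedUnder_of ⟨0, hlow⟩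
  have hbu : IsBoundedUnder (· ≤ ·) (folnerFilter G) u := isBoundedUnder_of ⟨_, hup⟩
  refine ⟨limsup u (folnerFilter G), tendsto_of_le_liminf_of_limsup_le ?_ le_rfl hbu hbl⟩
  set s := limsup u (folnerFilter G)
  set t := liminf u (folnerFilter G)
  have key : ∀ ε : ℝ, 0 < ε → ε ≤ 1 / 2 →
      s ≤ 4 * ε + ε ^ 2 + h {1} * ε + (t + ε ^ 2) / (1 - ε) := fun ε h1 h2 =>
    growth_le_of_filling hmono hsub hinv h0 h1 h2
      (eventually_lt_of_limsup_lt (lt_add_of_pos_right s (by positivity)) hbu)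
      (frequently_lt_of_lt_limsup hbl.isCoboundedUnder_le (sub_lt_self s (by positivity)))
      (frequently_lt_of_liminf_lt hbu.isCoboundedUnder_ge
        (lt_add_of_pos_right t (by positivity)))
  have hlim : Tendsto (fun ε : ℝ => 4 * ε + ε ^ 2 + h {1} * ε + (t + ε ^ 2) / (1 - ε))
      (nhdsWithin 0 (Set.Ioi 0)) (nhds t) := by
    have : ContinuousAt
        (fun ε : ℝ => 4 * ε + ε ^ 2 + h {1} * ε + (t + ε ^ 2) / (1 - ε)) 0 := by
      fun_prop (disch := norm_num)
    simpa using this.tendsto.mono_left nhdsWithin_le_nhds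
  refine ge_of_tendsto hlim ?_
  filter_upwards [Ioc_mem_nhdsGT (show (0 : ℝ) < 1 / 2 by norm_num)] with ε hε
  exact key ε hε.1 hε.2

end OrnsteinWeiss

end WPP

namespace WPP

section CoverInf

variable {G : Type} [Group G] (S : GSystem G)

/-- The infimum of `∑ φ (U j)` over finite open covers of `Ω` by sets of `d_F`-diameter `< ε`. -/
noncomputable def coverInf (F : Finset G) (ε : ℝ) (φ : Set S.carrier → ℝ)
    (Ω : Set S.carrier) : ℝ :=
  sInf {s | ∃ (n : ℕ) (U : Fin n → Set S.carrier),
      (∀ j, IsOpen (U j)) ∧ (Ω ⊆ ⋃ j, U j) ∧ (∀ j, diamLT S F (U j) ε) ∧ s = ∑ j, φ (U j)}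

variable {S} {F : Finset G} {ε : ℝ} {φ : Set S.carrier → ℝ} {Ω : Set S.carrier}

theorem coverInf_nonneg (hφ : ∀ U, 0 ≤ φ U) : 0 ≤ coverInf S F ε φ Ω := by
  refine Real.sInf_nonneg ?_
  rintro s ⟨n, U, -, -, -, rfl⟩
  exact Finset.sum_nonneg fun j _ => hφ _

theorem coverInf_le (hφ : ∀ U, 0 ≤ φ U) {ι : Type*} [Fintype ι] (U : ι → Set S.carrier)
    (hU : ∀ j, IsOpen (U j)) (hΩ : Ω ⊆ ⋃ j, U j) (hd : ∀ j, diamLT S F (U j) ε) :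
    coverInf S F ε φ Ω ≤ ∑ j, φ (U j) := by
  refine csInf_le ⟨0, ?_⟩ ⟨Fintype.card ι, fun j => U ((Fintype.equivFin ι).symm j),
    fun j => hU _, ?_, fun j => hd _, ?_⟩
  · rintro s ⟨n, U, -, -, -, rfl⟩
    exact Finset.sum_nonneg fun j _ => hφ _
  · rwa [(Fintype.equivFin ι).symm.surjective.iUnion_comp U]
  · exact ((Fintype.equivFin ι).symm.sum_comp fun j => φ (U j)).symm

theorem dynDist_lt_iff (hε : 0 < ε) {x y : S.carrier} :
    dynDist S F x y < ε ↔ ∀ g ∈ F, dist (S.act g x) (S.act g y) < ε := by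
  lift ε to ℝ≥0 using hε.le
  rw [dynDist, NNReal.coe_lt_coe, Finset.sup_lt_iff (by exact_mod_cast hε)]
  simp only [← NNReal.coe_lt_coe, coe_nndist]

theorem exists_finite_cover (S : GSystem G) (F : Finset G) (hε : 0 < ε) :
    ∃ (n : ℕ) (U : Fin n → Set S.carrier), (∀ j, IsOpen (U j)) ∧ (Set.univ ⊆ ⋃ j, U j) ∧
      ∀ j, diamLT S F (U j) ε := by
  let V : S.carrier → Set S.carrier := fun x =>
    ⋂ g ∈ F, S.act g ⁻¹' Metric.ball (S.act g x) (ε / 2)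
  have hV : ∀ x, IsOpen (V x) := fun x =>
    isOpen_biInter_finset fun g _ => Metric.isOpen_ball.preimage (S.cont_act g)
  obtain ⟨t, ht⟩ := isCompact_univ.elim_finite_subcover V hV fun x _ =>
    Set.mem_iUnion.2 ⟨x, Set.mem_iInter₂.2 fun g _ => Metric.mem_ball_self (half_pos hε)⟩
  refine ⟨t.card, fun j => V (t.equivFin.symm j), fun j => hV _, ?_, fun j x hx y hy => ?_⟩
  · intro x hx
    obtain ⟨c, hc, hxc⟩ := Set.mem_iUnion₂.1 (ht hx)
    exact Set.mem_iUnion.2 ⟨t.equivFin ⟨c, hc⟩, by simpa using hxc⟩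
  · rw [dynDist_lt_iff hε]
    intro g hg
    have h1 := Metric.mem_ball.1 (Set.mem_iInter₂.1 hx g hg)
    have h2 := Metric.mem_ball.1 (Set.mem_iInter₂.1 hy g hg)
    linarith [dist_triangle_right (S.act g x) (S.act g y) (S.act g (t.equivFin.symm j))]

theorem le_coverInf (hε : 0 < ε) {b : ℝ}
    (h : ∀ (n : ℕ) (U : Fin n → Set S.carrier), (∀ j, IsOpen (U j)) → (Ω ⊆ ⋃ j, U j) →
      (∀ j, diamLT S F (U j) ε) → b ≤ ∑ j, φ (U j)) :
    b ≤ coverInf S F ε φ Ω := by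
  refine le_csInf ?_ ?_
  · obtain ⟨n, U, hU, hc, hd⟩ := exists_finite_cover S F hε
    exact ⟨_, n, U, hU, (Set.subset_univ Ω).trans hc, hd, rfl⟩
  · rintro s ⟨n, U, hU, hc, hd, rfl⟩
    exact h n U hU hc hd

theorem le_coverInf_of_nonempty (hε : 0 < ε) (hφ : ∀ U, 0 ≤ φ U) (hΩ : Ω.Nonempty) {b : ℝ}
    (h : ∀ U : Set S.carrier, U.Nonempty → b ≤ φ U) : b ≤ coverInf S F ε φ Ω := by
  refine le_coverInf hε fun n U _ hc _ => ?_
  obtain ⟨x, hx⟩ := hΩ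
  obtain ⟨j, hj⟩ := Set.mem_iUnion.1 (hc hx)
  exact (h _ ⟨x, hj⟩).trans
    (Finset.single_le_sum (fun i _ => hφ (U i)) (Finset.mem_univ j))

theorem le_mul_coverInf (hε : 0 < ε) {b c : ℝ} (hb : 0 ≤ b)
    (h : ∀ (n : ℕ) (U : Fin n → Set S.carrier), (∀ j, IsOpen (U j)) → (Ω ⊆ ⋃ j, U j) →
      (∀ j, diamLT S F (U j) ε) → c ≤ b * ∑ j, φ (U j)) :
    c ≤ b * coverInf S F ε φ Ω := by
  rcases hb.eq_or_lt with rfl | hb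
  · obtain ⟨n, U, hU, hc, hd⟩ := exists_finite_cover S F hε
    simpa using h n U hU ((Set.subset_univ Ω).trans hc) hd
  · rw [← div_le_iff₀' hb]
    exact le_coverInf hε fun n U hU hc hd => (div_le_iff₀' hb).2 (h n U hU hc hd)

theorem coverInf_preimage_le (hε : 0 < ε) (hφ : ∀ U, 0 ≤ φ U) {F' : Finset G}
    {φ' : Set S.carrier → ℝ} {c : ℝ} (hc : 0 ≤ c) {p : S.carrier → S.carrier}
    (hp : Continuous p) (hd : ∀ U, diamLT S F' U ε → diamLT S F (p ⁻¹' U) ε)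
    (h : ∀ U, φ (p ⁻¹' U) ≤ c * φ' U) :
    coverInf S F ε φ (p ⁻¹' Ω) ≤ c * coverInf S F' ε φ' Ω := by
  refine le_mul_coverInf hε hc fun n U hU hcov hUd => ?_
  rw [Finset.mul_sum]
  refine (coverInf_le hφ (fun j => p ⁻¹' U j) (fun j => (hU j).preimage hp) ?_
    fun j => hd _ (hUd j)).trans (Finset.sum_le_sum fun j _ => h _)
  rw [← Set.preimage_iUnion]
  exact Set.preimage_mono hcov

theorem coverInf_inter_le [DecidableEq G] (hε : 0 < ε) (hφ : ∀ U, 0 ≤ φ U) {E : Finset G}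
    {φ₁ φ₂ : Set S.carrier → ℝ} (hφ₁ : ∀ U, 0 ≤ φ₁ U) (hφ₂ : ∀ U, 0 ≤ φ₂ U)
    (h : ∀ U V : Set S.carrier, (U ∩ V).Nonempty → φ (U ∩ V) ≤ φ₁ U * φ₂ V)
    (Ω Ω' : Set S.carrier) :
    coverInf S (E ∪ F) ε φ (Ω ∩ Ω') ≤ coverInf S E ε φ₁ Ω * coverInf S F ε φ₂ Ω' := by
  classical
  have key : ∀ (n : ℕ) (U : Fin n → Set S.carrier), (∀ j, IsOpen (U j)) → (Ω ⊆ ⋃ j, U j) →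
      (∀ j, diamLT S E (U j) ε) → ∀ (m : ℕ) (V : Fin m → Set S.carrier), (∀ j, IsOpen (V j)) →
      (Ω' ⊆ ⋃ j, V j) → (∀ j, diamLT S F (V j) ε) →
      coverInf S (E ∪ F) ε φ (Ω ∩ Ω') ≤ (∑ j, φ₁ (U j)) * ∑ j, φ₂ (V j) := by
    intro n U hU hUc hUd m V hV hVc hVd
    let I := {q : Fin n × Fin m // (U q.1 ∩ V q.2).Nonempty}
    refine (coverInf_le hφ (fun q : I => U q.1.1 ∩ V q.1.2) (fun q => (hU _).inter (hV _))
      ?_ ?_).trans ((Finset.sum_le_sum fun q _ => h _ _ q.2).trans ?_)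
    · rintro x ⟨hx, hx'⟩
      obtain ⟨i, hi⟩ := Set.mem_iUnion.1 (hUc hx)
      obtain ⟨j, hj⟩ := Set.mem_iUnion.1 (hVc hx')
      exact Set.mem_iUnion.2 ⟨⟨(i, j), x, hi, hj⟩, hi, hj⟩
    · rintro q x ⟨hx, hx'⟩ y ⟨hy, hy'⟩
      have h1 := (dynDist_lt_iff hε).1 (hUd _ x hx y hy)
      have h2 := (dynDist_lt_iff hε).1 (hVd _ x hx' y hy')
      refine (dynDist_lt_iff hε).2 fun g hg => ?_
      exact (Finset.mem_union.1 hg).elim (h1 g) (h2 g)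
    · rw [Fintype.sum_mul_sum, ← Fintype.sum_prod_type' fun i j => φ₁ (U i) * φ₂ (V j)]
      rw [← Fintype.sum_subtype_add_sum_subtype fun q : Fin n × Fin m => (U q.1 ∩ V q.2).Nonempty]
      exact le_add_of_nonneg_right (Finset.sum_nonneg fun q _ => mul_nonneg (hφ₁ _) (hφ₂ _))
  refine le_mul_coverInf hε (coverInf_nonneg hφ₁) fun m V hV hVc hVd => ?_
  rw [mul_comm]
  refine le_mul_coverInf hε (Finset.sum_nonneg fun j _ => hφ₂ _) fun n U hU hUc hUd => ?_
  rw [mul_comm]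
  exact key n U hU hUc hUd m V hV hVc hVd

end CoverInf

section Recursion

variable {G : Type} [Group G] {X : ℕ → GSystem G} {π : ∀ i, FactorMap (X i) (X (i + 1))}
  {a : ℕ → ℝ} {f : (X 0).carrier → ℝ} {F : Finset G} {ε : ℝ}

theorem wP_zero (Ω : Set (X 0).carrier) : wP X π a f F ε 0 Ω =
    coverInf (X 0) F ε (fun U => Real.exp (sSup (birk (X 0) f F '' U))) Ω := by
  rw [wP, coverInf]

theorem wP_succ (i : ℕ) (Ω : Set (X (i + 1)).carrier) : wP X π a f F ε (i + 1) Ω =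
    coverInf (X (i + 1)) F ε (fun U => (wP X π a f F ε i ((π i).toFun ⁻¹' U)) ^ a i) Ω := by
  rw [wP, coverInf]

theorem wP_nonneg (i : ℕ) (Ω : Set (X i).carrier) : 0 ≤ wP X π a f F ε i Ω := by
  induction i with
  | zero => exact wP_zero Ω ▸ coverInf_nonneg fun U => (Real.exp_pos _).le
  | succ i ih => exact wP_succ i Ω ▸ coverInf_nonneg fun U => Real.rpow_nonneg (ih _) _


theorem wP_empty (i : ℕ) : wP X π a f F ε i ∅ = 0 := by
  refine le_antisymm ?_ (wP_nonneg i ∅)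
  cases i with
  | zero =>
    rw [wP_zero]
    simpa using coverInf_le (Ω := ∅) (ε := ε) (F := F)
      (φ := fun U => Real.exp (sSup (birk (X 0) f F '' U))) (fun _ => (Real.exp_pos _).le)
      (fun j : Empty => j.elim) (fun j => j.elim) (Set.empty_subset _) fun j => j.elim
  | succ i =>
    rw [wP_succ]
    simpa using coverInf_le (Ω := ∅) (ε := ε) (F := F)
      (φ := fun U => wP X π a f F ε i ((π i).toFun ⁻¹' U) ^ a i)
      (fun _ => Real.rpow_nonneg (wP_nonneg _ _) _)
      (fun j : Empty => j.elim) (fun j => j.elim) (Set.empty_subset _) fun j => j.elim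

theorem abs_birk_le {M : ℝ} (hM : ∀ x, |f x| ≤ M) (F : Finset G) (x : (X 0).carrier) :
    |birk (X 0) f F x| ≤ M * F.card := by
  refine (Finset.abs_sum_le_sum_abs _ _).trans ?_
  rw [mul_comm, ← nsmul_eq_mul]
  exact Finset.sum_le_card_nsmul _ _ _ fun g _ => hM _

theorem bddAbove_birk {M : ℝ} (hM : ∀ x, |f x| ≤ M) (F : Finset G) (U : Set (X 0).carrier) :
    BddAbove (birk (X 0) f F '' U) :=
  ⟨M * F.card, by rintro _ ⟨x, -, rfl⟩; exact (abs_le.1 (abs_birk_le hM F x)).2⟩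

theorem exp_neg_le_wP {M : ℝ} (hM0 : 0 ≤ M) (hM : ∀ x, |f x| ≤ M) (hε : 0 < ε) (i : ℕ)
    (ha : ∀ j < i, a j ∈ Set.Icc (0 : ℝ) 1) {Ω : Set (X i).carrier} (hΩ : Ω.Nonempty) :
    Real.exp (-(M * F.card)) ≤ wP X π a f F ε i Ω := by
  induction i with
  | zero =>
    rw [wP_zero]
    refine le_coverInf_of_nonempty hε (fun _ => (Real.exp_pos _).le) hΩ ?_
    rintro U ⟨x, hx⟩
    exact Real.exp_le_exp.2 ((abs_le.1 (abs_birk_le hM F x)).1.trans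
      (le_csSup (bddAbove_birk hM F U) ⟨x, hx, rfl⟩))
  | succ i ih =>
    rw [wP_succ]
    refine le_coverInf_of_nonempty hε (fun _ => Real.rpow_nonneg (wP_nonneg _ _) _) hΩ ?_
    intro U hU
    have hai := ha i i.lt_succ_self
    have h1 := ih (fun j hj => ha j (hj.trans i.lt_succ_self)) (hU.preimage (π i).surj)
    have h2 : Real.exp (-(M * F.card)) ≤ Real.exp (-(M * F.card)) ^ a i := by
      rw [← Real.exp_mul]
      refine Real.exp_le_exp.2 ?_
      have : 0 ≤ M * F.card := by positivity
      nlinarith [hai.2]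
    exact h2.trans (Real.rpow_le_rpow (Real.exp_pos _).le h1 hai.1)

theorem wP_empty_le_one (hε : 0 < ε) (i : ℕ) (ha : ∀ j < i, a j ∈ Set.Icc (0 : ℝ) 1)
    (Ω : Set (X i).carrier) : wP X π a f (∅ : Finset G) ε i Ω ≤ 1 := by
  have hd : ∀ (i : ℕ) (U : Set (X i).carrier), diamLT (X i) (∅ : Finset G) U ε :=
    fun i U x _ y _ => (dynDist_lt_iff hε).2 (by simp)
  induction i with
  | zero =>
    rw [wP_zero]
    refine (coverInf_le (fun _ => (Real.exp_pos _).le) (fun _ : Unit => Set.univ)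
      (fun _ => isOpen_univ) (fun x _ => Set.mem_iUnion.2 ⟨(), trivial⟩)
      fun _ => hd _ _).trans ?_
    simp only [Finset.univ_unique, Finset.sum_singleton, Real.exp_le_one_iff]
    refine Real.sSup_nonpos ?_
    rintro _ ⟨x, -, rfl⟩
    simp [birk]
  | succ i ih =>
    rw [wP_succ]
    refine (coverInf_le (fun _ => Real.rpow_nonneg (wP_nonneg _ _) _) (fun _ : Unit => Set.univ)
      (fun _ => isOpen_univ) (fun x _ => Set.mem_iUnion.2 ⟨(), trivial⟩)
      fun _ => hd _ _).trans ?_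
    simp only [Finset.univ_unique, Finset.sum_singleton]
    exact Real.rpow_le_one (wP_nonneg _ _)
      (ih (fun j hj => ha j (hj.trans i.lt_succ_self)) _) (ha i i.lt_succ_self).1

theorem wP_mono [DecidableEq G] {M : ℝ} (hM0 : 0 ≤ M) (hM : ∀ x, |f x| ≤ M) (hε : 0 < ε) (i : ℕ)
    (ha : ∀ j < i, a j ∈ Set.Icc (0 : ℝ) 1) {E : Finset G} (hEF : E ⊆ F)
    (Ω : Set (X i).carrier) :
    wP X π a f E ε i Ω ≤ Real.exp (M * (F \ E).card) * wP X π a f F ε i Ω := by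
  have hd : ∀ (i : ℕ) (U : Set (X i).carrier), diamLT (X i) F U ε → diamLT (X i) E (id ⁻¹' U) ε :=
    fun i U hU x hx y hy => (dynDist_lt_iff hε).2 fun g hg =>
      (dynDist_lt_iff hε).1 (hU x hx y hy) g (hEF hg)
  have hc : 0 ≤ M * (F \ E).card := by positivity
  induction i with
  | zero =>
    rw [wP_zero, wP_zero]
    refine coverInf_preimage_le (p := id) hε (fun _ => (Real.exp_pos _).le) (Real.exp_pos _).le
      continuous_id (hd 0) fun U => ?_
    rw [← Real.exp_add, Real.exp_le_exp, Set.preimage_id]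
    rcases U.eq_empty_or_nonempty with rfl | hU
    · simpa using hc
    refine csSup_le (hU.image _) ?_
    rintro _ ⟨x, hx, rfl⟩
    have h1 : birk (X 0) f (F \ E) x + birk (X 0) f E x = birk (X 0) f F x :=
      Finset.sum_sdiff hEF
    have h2 := (abs_le.1 (abs_birk_le hM (F \ E) x)).1
    have h3 := le_csSup (bddAbove_birk hM F U) ⟨x, hx, rfl⟩
    linarith
  | succ i ih =>
    rw [wP_succ, wP_succ]
    refine coverInf_preimage_le (p := id) hε (fun _ => Real.rpow_nonneg (wP_nonneg _ _) _)
      (Real.exp_pos _).le continuous_id (hd _) fun U => ?_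
    have hai := ha i i.lt_succ_self
    have h1 := ih (fun j hj => ha j (hj.trans i.lt_succ_self)) ((π i).toFun ⁻¹' U)
    refine (Real.rpow_le_rpow (wP_nonneg _ _) h1 hai.1).trans ?_
    rw [Real.mul_rpow (Real.exp_pos _).le (wP_nonneg _ _)]
    refine mul_le_mul_of_nonneg_right ?_ (Real.rpow_nonneg (wP_nonneg _ _) _)
    exact Real.rpow_le_self_of_one_le (Real.one_le_exp hc) hai.2

theorem wP_inter_le [DecidableEq G] {M : ℝ} (hM : ∀ x, |f x| ≤ M) (hε : 0 < ε) (i : ℕ)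
    (ha : ∀ j < i, a j ∈ Set.Icc (0 : ℝ) 1) {E : Finset G} (hEF : Disjoint E F)
    (Ω Ω' : Set (X i).carrier) :
    wP X π a f (E ∪ F) ε i (Ω ∩ Ω') ≤ wP X π a f E ε i Ω * wP X π a f F ε i Ω' := by
  induction i with
  | zero =>
    rw [wP_zero, wP_zero, wP_zero]
    refine coverInf_inter_le hε (fun _ => (Real.exp_pos _).le) (fun _ => (Real.exp_pos _).le)
      (fun _ => (Real.exp_pos _).le) (fun U V hUV => ?_) Ω Ω'
    rw [← Real.exp_add, Real.exp_le_exp]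
    refine csSup_le (hUV.image _) ?_
    rintro _ ⟨x, hx, rfl⟩
    have h1 : birk (X 0) f (E ∪ F) x = birk (X 0) f E x + birk (X 0) f F x :=
      Finset.sum_union hEF
    rw [h1]
    exact add_le_add (le_csSup (bddAbove_birk hM E U) ⟨x, hx.1, rfl⟩)
      (le_csSup (bddAbove_birk hM F V) ⟨x, hx.2, rfl⟩)
  | succ i ih =>
    rw [wP_succ, wP_succ, wP_succ]
    refine coverInf_inter_le hε (fun _ => Real.rpow_nonneg (wP_nonneg _ _) _)
      (fun _ => Real.rpow_nonneg (wP_nonneg _ _) _)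
      (fun _ => Real.rpow_nonneg (wP_nonneg _ _) _) (fun U V _ => ?_) Ω Ω'
    rw [← Real.mul_rpow (wP_nonneg _ _) (wP_nonneg _ _), Set.preimage_inter]
    exact Real.rpow_le_rpow (wP_nonneg _ _)
      (ih (fun j hj => ha j (hj.trans i.lt_succ_self)) _ _) (ha i i.lt_succ_self).1

theorem wP_image_mul_right_le [DecidableEq G] (hε : 0 < ε) (i : ℕ)
    (ha : ∀ j < i, a j ∈ Set.Icc (0 : ℝ) 1) (g : G) (Ω : Set (X i).carrier) :
    wP X π a f (F.image fun x => x * g) ε i ((X i).act g ⁻¹' Ω) ≤ wP X π a f F ε i Ω := by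
  have hd : ∀ (i : ℕ) (U : Set (X i).carrier), diamLT (X i) F U ε →
      diamLT (X i) (F.image fun x => x * g) ((X i).act g ⁻¹' U) ε := by
    intro i U hU x hx y hy
    refine (dynDist_lt_iff hε).2 fun k hk => ?_
    obtain ⟨l, hl, rfl⟩ := Finset.mem_image.1 hk
    rw [(X i).mul_act, (X i).mul_act]
    exact (dynDist_lt_iff hε).1 (hU _ hx _ hy) l hl
  rw [← one_mul (wP X π a f F ε i Ω)]
  induction i with
  | zero =>
    rw [wP_zero, wP_zero]
    refine coverInf_preimage_le hε (fun _ => (Real.exp_pos _).le) zero_le_one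
      ((X 0).cont_act g) (hd 0) fun U => ?_
    rw [one_mul]
    have hbirk : ∀ x, birk (X 0) f (F.image fun x => x * g) x = birk (X 0) f F ((X 0).act g x) := by
      intro x
      rw [birk, Finset.sum_image fun _ _ _ _ h => mul_right_cancel h]
      simp_rw [(X 0).mul_act]
      rfl
    have hsurj : Function.Surjective ((X 0).act g) := fun y =>
      ⟨(X 0).act g⁻¹ y, by rw [← (X 0).mul_act, mul_inv_cancel, (X 0).one_act]⟩
    rw [funext hbirk, ← Function.comp_def, Set.image_comp, Set.image_preimage_eq _ hsurj]
  | succ i ih =>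
    rw [wP_succ, wP_succ]
    refine coverInf_preimage_le hε (fun _ => Real.rpow_nonneg (wP_nonneg _ _) _) zero_le_one
      ((X (i + 1)).cont_act g) (hd _) fun U => ?_
    rw [one_mul]
    have hpre : (π i).toFun ⁻¹' ((X (i + 1)).act g ⁻¹' U)
        = (X i).act g ⁻¹' ((π i).toFun ⁻¹' U) := by
      ext x
      simp only [Set.mem_preimage, (π i).equiv]
    have := ih (fun j hj => ha j (hj.trans i.lt_succ_self)) ((π i).toFun ⁻¹' U)
    rw [one_mul] at this
    rw [hpre]
    exact Real.rpow_le_rpow (wP_nonneg _ _) this (ha i i.lt_succ_self).1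

theorem wP_image_mul_right [DecidableEq G] (hε : 0 < ε) (i : ℕ)
    (ha : ∀ j < i, a j ∈ Set.Icc (0 : ℝ) 1) (F : Finset G) (g : G) :
    wP X π a f (F.image fun x => x * g) ε i Set.univ = wP X π a f F ε i Set.univ := by
  refine le_antisymm (wP_image_mul_right_le hε i ha g Set.univ) ?_
  have h := wP_image_mul_right_le (π := π) (f := f) (F := F.image fun x => x * g)
    hε i ha g⁻¹ Set.univ
  have hF : (F.image fun x => x * g).image (fun x => x * g⁻¹) = F := by
    rw [Finset.image_image]
    simp only [Function.comp_def, mul_inv_cancel_right, Finset.image_id']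
  rwa [hF] at h

end Recursion

end WPP

open WPP Filter in
/-- For every `f ∈ C(X_1)` and every `ε > 0`, the function
`F ↦ log P^a_r(X_r,f,F,ε)` on nonempty finite subsets of `G` is right-invariant and
sub-additive on disjoint unions, and consequently
`lim_n log P^a_r(X_r,f,F_n,ε)/|F_n|` exists for every Følner sequence of `G` and is
independent of the choice of Følner sequence. -/
theorem log_wP_invariant_subadditive_and_limit_exists
    {G : Type} [Group G] [Countable G] [Infinite G] [DecidableEq G]
    (hG : ∃ Fseq : ℕ → Finset G, IsFolner G Fseq)
    (X : ℕ → GSystem G) (π : ∀ i, FactorMap (X i) (X (i + 1)))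
    (r : ℕ) (hr : 2 ≤ r) (a : ℕ → ℝ) (ha : ∀ i < r - 1, a i ∈ Set.Icc (0 : ℝ) 1)
    (f : (X 0).carrier → ℝ) (hf : Continuous f) (ε : ℝ) (hε : 0 < ε) :
    (∀ (F : Finset G) (g : G), F.Nonempty →
        Real.log (wP X π a f (F.image (fun x => x * g)) ε (r - 1) Set.univ)
          = Real.log (wP X π a f F ε (r - 1) Set.univ)) ∧
    (∀ E F : Finset G, E.Nonempty → F.Nonempty → Disjoint E F →
        Real.log (wP X π a f (E ∪ F) ε (r - 1) Set.univ)
          ≤ Real.log (wP X π a f E ε (r - 1) Set.univ)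
            + Real.log (wP X π a f F ε (r - 1) Set.univ)) ∧
    (∃ L : ℝ, ∀ Fn : ℕ → Finset G, IsFolner G Fn →
        Tendsto (fun n =>
          Real.log (wP X π a f (Fn n) ε (r - 1) Set.univ) / ((Fn n).card : ℝ))
          atTop (nhds L)) := by
  obtain ⟨M, hM⟩ := isCompact_univ.exists_bound_of_continuousOn hf.continuousOn
  replace hM : ∀ x, |f x| ≤ max M 0 := fun x => (hM x trivial).trans (le_max_left _ _)
  have hM0 : 0 ≤ max M 0 := le_max_right _ _
  set B := max M 0
  set p : Finset G → ℝ := fun F => wP X π a f F ε (r - 1) Set.univ with hp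
  have hinv : ∀ F g, p (F.image fun x => x * g) = p F := wP_image_mul_right hε (r - 1) ha
  rcases isEmpty_or_nonempty (X (r - 1)).carrier with hX | hX
  · have hp0 : ∀ F, wP X π a f F ε (r - 1) Set.univ = 0 := fun F => by
      rw [Set.univ_eq_empty_iff.2 hX, wP_empty]
    exact ⟨by simp [hp0], by simp [hp0], 0, by simp [hp0]⟩
  have hpos : ∀ F, 0 < p F := fun F =>
    (Real.exp_pos _).trans_le (exp_neg_le_wP hM0 hM hε (r - 1) ha Set.univ_nonempty)
  have hsub : ∀ E F, Disjoint E F → Real.log (p (E ∪ F)) ≤ Real.log (p E) + Real.log (p F) := by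
    intro E F hEF
    rw [← Real.log_mul (hpos E).ne' (hpos F).ne']
    refine Real.log_le_log (hpos _) ?_
    simpa only [Set.univ_inter] using
      wP_inter_le (π := π) hM hε (r - 1) ha hEF Set.univ Set.univ
  refine ⟨fun F g _ => congrArg Real.log (hinv F g), fun E F _ _ => hsub E F, ?_⟩
  set h : Finset G → ℝ := fun F => Real.log (p F) + B * F.card with hh
  have hmono : Monotone h := by
    intro E F hEF
    have h1 := Real.log_le_log (hpos E)
      (wP_mono (π := π) hM0 hM hε (r - 1) ha hEF Set.univ)
    rw [Real.log_mul (Real.exp_pos _).ne' (hpos F).ne', Real.log_exp] at h1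
    have h2 : ((F \ E).card : ℝ) + E.card = F.card := by
      exact_mod_cast Finset.card_sdiff_add_card_eq_card hEF
    simp only [hh, ← h2]
    linarith
  have hsub' : ∀ E F, h (E ∪ F) ≤ h E + h F := by
    intro E F
    have h1 := hsub E (F \ E) Finset.disjoint_sdiff
    rw [Finset.union_sdiff_self_eq_union] at h1
    have h2 : ((E ∪ F).card : ℝ) = E.card + (F \ E).card := by
      rw [← Finset.union_sdiff_self_eq_union, Finset.card_union_of_disjoint Finset.disjoint_sdiff]
      push_cast
      rfl
    have h3 : h (F \ E) ≤ h F := hmono Finset.sdiff_subset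
    simp only [hh, h2] at h3 ⊢
    linarith
  have h0 : h ∅ = 0 := by
    have h1 : 1 ≤ p ∅ := by
      simpa using exp_neg_le_wP (π := π) (F := ∅) hM0 hM hε (r - 1) ha Set.univ_nonempty
    have h2 : p ∅ = 1 := le_antisymm (wP_empty_le_one hε (r - 1) ha Set.univ) h1
    simp [hh, h2]
  have hinv' : ∀ F g, h (F.image fun x => x * g) = h F := by
    intro F g
    simp only [hh, hinv, Finset.card_image_of_injective F (mul_left_injective g)]
  obtain ⟨Fseq, hFseq⟩ := hG
  have : (folnerFilter G).NeBot := hFseq.tendsto_folnerFilter.neBot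
  obtain ⟨l, hl⟩ := exists_tendsto_div_card hmono hsub' hinv' h0
  refine ⟨l - B, fun Fn hFn => ?_⟩
  refine ((hl.comp hFn.tendsto_folnerFilter).sub_const B).congr fun n => ?_
  have hn : ((Fn n).card : ℝ) ≠ 0 := by exact_mod_cast (hFn.1 n).card_pos.ne'
  simp only [Function.comp_apply, hh, hp]
  field_simp
  ring
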